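/- arXiv:1408.1886 — 2 statements merged into one kernel-verified Lean document; each statement's English description precedes it below -/
import Mathlib

section
/- For all n ≥ 0, f(n+1) = Σ_{k=0}^{⌊(n−1)/2⌋} C(n,2k)·f(2k)·f(n−2k) + f(n) if n is even, and f(n+1) = Σ_{k=0}^{⌊(n−1)/2⌋} C(n,2k)·f(2k)·f(n−2k) + g(n) if n is odd (the sum is empty when n = 0). -/
/-- The entry of the permutation `σ` of `[n]` at (1-based) position `i`,
as a value in `{1, …, n}`; `0` if `i` is out of range. -/
def permEnt {n : ℕ} (σ : Equiv.Perm (Fin n)) (i : ℕ) : ℕ :=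
  if h : 1 ≤ i ∧ i ≤ n then (σ ⟨i - 1, by omega⟩ : ℕ) + 1 else 0

/-- `i` is a descent of `σ`: `1 ≤ i ≤ n−1` and `π_i > π_{i+1}`. -/
def IsDescent {n : ℕ} (σ : Equiv.Perm (Fin n)) (i : ℕ) : Prop :=
  1 ≤ i ∧ i < n ∧ permEnt σ (i + 1) < permEnt σ i

/-- `i` is an alternating descent of `σ`: `i` odd with `π_i > π_{i+1}`,
or `i` even with `π_i < π_{i+1}`. -/
def IsAltDescent {n : ℕ} (σ : Equiv.Perm (Fin n)) (i : ℕ) : Prop :=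
  1 ≤ i ∧ i < n ∧
    ((i % 2 = 1 ∧ permEnt σ (i + 1) < permEnt σ i) ∨
     (i % 2 = 0 ∧ permEnt σ i < permEnt σ (i + 1)))

instance {n : ℕ} (σ : Equiv.Perm (Fin n)) (i : ℕ) : Decidable (IsDescent σ i) := by
  unfold IsDescent; infer_instance

instance {n : ℕ} (σ : Equiv.Perm (Fin n)) (i : ℕ) : Decidable (IsAltDescent σ i) := by
  unfold IsAltDescent; infer_instance

/-- `i` is a peak of `σ`: `2 ≤ i ≤ n−1` and `π_{i−1} < π_i > π_{i+1}`. -/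
def IsPeak {n : ℕ} (σ : Equiv.Perm (Fin n)) (i : ℕ) : Prop :=
  2 ≤ i ∧ i < n ∧ permEnt σ (i - 1) < permEnt σ i ∧ permEnt σ (i + 1) < permEnt σ i

/-- `i` is a valley of `σ`: `2 ≤ i ≤ n−1` and `π_{i−1} > π_i < π_{i+1}`. -/
def IsValley {n : ℕ} (σ : Equiv.Perm (Fin n)) (i : ℕ) : Prop :=
  2 ≤ i ∧ i < n ∧ permEnt σ i < permEnt σ (i - 1) ∧ permEnt σ i < permEnt σ (i + 1)

/-- All valleys of `σ` are even and all peaks of `σ` are odd. -/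
def GoodPerm {n : ℕ} (σ : Equiv.Perm (Fin n)) : Prop :=
  (∀ i, IsValley σ i → i % 2 = 0) ∧ (∀ i, IsPeak σ i → i % 2 = 1)

/-- `f n` is the number of permutations of `[n]` with all valleys even and all peaks odd. -/
noncomputable def fCount (n : ℕ) : ℕ :=
  Nat.card {σ : Equiv.Perm (Fin n) // GoodPerm σ}

/-- `g n` is the number of permutations of `[n]` with all valleys even and all peaks odd
having no descent at position `n − 1`. -/
noncomputable def gCount (n : ℕ) : ℕ :=
  Nat.card {σ : Equiv.Perm (Fin n) // GoodPerm σ ∧ ¬ IsDescent σ (n - 1)}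

/-- `σ` is an alternating permutation: `π₁ > π₂ < π₃ > π₄ < ⋯`. -/
def IsAltPerm {n : ℕ} (σ : Equiv.Perm (Fin n)) : Prop :=
  ∀ i, 1 ≤ i → i < n →
    (i % 2 = 1 → permEnt σ (i + 1) < permEnt σ i) ∧
    (i % 2 = 0 → permEnt σ i < permEnt σ (i + 1))

/-- The Euler number `Eₙ`, the number of alternating permutations of `[n]`. -/
noncomputable def eulerNum (n : ℕ) : ℕ :=
  Nat.card {σ : Equiv.Perm (Fin n) // IsAltPerm σ}

/-- The word built from a set `s` of `a` values, a pattern for the left part and a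
(complemented) pattern for the right part, with the maximum in the middle. -/
def glueFun {a b : ℕ} (s : Finset (Fin (a + b))) (hs : s.card = a) (hs' : sᶜ.card = b)
    (τ : Equiv.Perm (Fin a)) (ρ : Equiv.Perm (Fin b)) (i : Fin (a + b + 1)) : Fin (a + b + 1) :=
  if h : i.1 < a then (s.orderEmbOfFin hs (τ ⟨i.1, h⟩)).castSucc
  else if h2 : i.1 = a then Fin.last _
  else (sᶜ.orderEmbOfFin hs' (Fin.rev (ρ ⟨i.1 - a - 1, by omega⟩))).castSucc

theorem glueFun_injective {a b : ℕ} (s : Finset (Fin (a + b))) (hs : s.card = a)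
    (hs' : sᶜ.card = b) (τ : Equiv.Perm (Fin a)) (ρ : Equiv.Perm (Fin b)) :
    Function.Injective (glueFun s hs hs' τ ρ) := by
  have key : ∀ x y, s.orderEmbOfFin hs x ≠ sᶜ.orderEmbOfFin hs' y := by
    intro x y h
    have h1 := s.orderEmbOfFin_mem hs x
    have h2 := sᶜ.orderEmbOfFin_mem hs' y
    rw [← h] at h2
    exact (Finset.mem_compl.1 h2) h1
  intro i j hij
  unfold glueFun at hij
  split_ifs at hij with h1 h2 h3 h4 h5 h6 h7 h8
  · have := τ.injective ((s.orderEmbOfFin hs).injective (Fin.castSucc_injective _ hij))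
    exact Fin.ext (by simpa using this)
  · exact absurd hij (Fin.castSucc_lt_last _).ne
  · exact absurd (Fin.castSucc_injective _ hij) (key _ _)
  · exact absurd hij.symm (Fin.castSucc_lt_last _).ne
  · exact Fin.ext (by omega)
  · exact absurd hij.symm (Fin.castSucc_lt_last _).ne
  · exact absurd (Fin.castSucc_injective _ hij).symm (key _ _)
  · exact absurd hij (Fin.castSucc_lt_last _).ne
  · have := ρ.injective (Fin.rev_injective
      ((sᶜ.orderEmbOfFin hs').injective (Fin.castSucc_injective _ hij)))
    simp only [Fin.mk.injEq] at this
    exact Fin.ext (by omega)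

theorem compl_card_aux {a b : ℕ} (s : Finset (Fin (a + b))) (hs : s.card = a) :
    sᶜ.card = b := by
  rw [Finset.card_compl, hs, Fintype.card_fin]; omega

/-- The glued permutation. -/
noncomputable def glue {a b : ℕ} (s : {s : Finset (Fin (a + b)) // s.card = a})
    (τ : Equiv.Perm (Fin a)) (ρ : Equiv.Perm (Fin b)) : Equiv.Perm (Fin (a + b + 1)) :=
  Equiv.ofBijective _ (Finite.injective_iff_bijective.1
    (glueFun_injective s.1 s.2 (compl_card_aux s.1 s.2) τ ρ))

theorem glue_apply {a b : ℕ} (s : {s : Finset (Fin (a + b)) // s.card = a})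
    (τ : Equiv.Perm (Fin a)) (ρ : Equiv.Perm (Fin b)) (i) :
    glue s τ ρ i = glueFun s.1 s.2 (compl_card_aux s.1 s.2) τ ρ i := rfl

theorem glue_left {a b : ℕ} (s : {s : Finset (Fin (a + b)) // s.card = a})
    (τ : Equiv.Perm (Fin a)) (ρ : Equiv.Perm (Fin b)) (i : Fin a) :
    glue s τ ρ ⟨i.1, by omega⟩ = (s.1.orderEmbOfFin s.2 (τ i)).castSucc := by
  simp [glue_apply, glueFun]

theorem glue_mid {a b : ℕ} (s : {s : Finset (Fin (a + b)) // s.card = a})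
    (τ : Equiv.Perm (Fin a)) (ρ : Equiv.Perm (Fin b)) :
    glue s τ ρ ⟨a, by omega⟩ = Fin.last _ := by
  simp [glue_apply, glueFun]

theorem glue_right {a b : ℕ} (s : {s : Finset (Fin (a + b)) // s.card = a})
    (τ : Equiv.Perm (Fin a)) (ρ : Equiv.Perm (Fin b)) (i : Fin b) :
    glue s τ ρ ⟨a + 1 + i.1, by omega⟩ =
      (s.1ᶜ.orderEmbOfFin (compl_card_aux s.1 s.2) (Fin.rev (ρ i))).castSucc := by
  have h1 : ¬ (a + 1 + i.1 < a) := by omega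
  have h2 : ¬ (a + 1 + i.1 = a) := by omega
  have h3 : a + 1 + i.1 - a - 1 = i.1 := by omega
  simp [glue_apply, glueFun, h1, h2, h3]

theorem glue_inj {a b : ℕ} (s s' : {s : Finset (Fin (a + b)) // s.card = a})
    (τ τ' : Equiv.Perm (Fin a)) (ρ ρ' : Equiv.Perm (Fin b))
    (h : glue s τ ρ = glue s' τ' ρ') : s = s' ∧ τ = τ' ∧ ρ = ρ' := by
  have sub : ∀ (s s' : {s : Finset (Fin (a + b)) // s.card = a})
      (τ τ' : Equiv.Perm (Fin a)) (ρ ρ' : Equiv.Perm (Fin b))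
      (_ : glue s τ ρ = glue s' τ' ρ'), s.1 ⊆ s'.1 := by
    intro s s' τ τ' ρ ρ' h x hx
    have : x ∈ Set.range (s.1.orderEmbOfFin s.2) := by
      rw [Finset.range_orderEmbOfFin]; exact hx
    obtain ⟨y, rfl⟩ := this
    have h1 := glue_left s τ ρ (τ.symm y)
    rw [h, glue_left] at h1
    have h2 := Fin.castSucc_injective _ h1
    rw [Equiv.apply_symm_apply] at h2
    rw [← h2]
    exact Finset.orderEmbOfFin_mem _ _ _
  obtain rfl : s = s' := Subtype.ext (Finset.Subset.antisymm (sub _ _ _ _ _ _ h)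
    (sub _ _ _ _ _ _ h.symm))
  refine ⟨rfl, ?_, ?_⟩
  · ext i
    have h1 := glue_left s τ ρ i
    rw [h, glue_left] at h1
    have h2 := Fin.castSucc_injective _ h1
    rw [(s.1.orderEmbOfFin s.2).injective h2]
  · ext i
    have h1 := glue_right s τ ρ i
    rw [h, glue_right] at h1
    have h2 := Fin.castSucc_injective _ h1
    rw [Fin.rev_injective ((s.1ᶜ.orderEmbOfFin _).injective h2)]

theorem glue_surj {a b : ℕ} (σ : Equiv.Perm (Fin (a + b + 1)))
    (hσ : σ ⟨a, by omega⟩ = Fin.last _) : ∃ s τ ρ, glue (a := a) (b := b) s τ ρ = σ := by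
  have hne : ∀ i : Fin (a + b + 1), i.1 ≠ a → σ i ≠ Fin.last _ := by
    intro i hi h
    rw [← hσ] at h
    exact hi (by simpa using congrArg Fin.val (σ.injective h))
  let L : Fin a → Fin (a + b) := fun i =>
    (σ ⟨i.1, by omega⟩).castPred (hne _ (by simp; omega))
  let R : Fin b → Fin (a + b) := fun i =>
    (σ ⟨a + 1 + i.1, by omega⟩).castPred (hne _ (by simp; omega))
  have hL : Function.Injective L := by
    intro i j h
    have := σ.injective ((Fin.castPred_inj).1 h)
    simpa [Fin.ext_iff] using this
  have hR : Function.Injective R := by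
    intro i j h
    have := σ.injective ((Fin.castPred_inj).1 h)
    simpa [Fin.ext_iff] using this
  have hLR : ∀ i j, L i ≠ R j := by
    intro i j h
    have := σ.injective ((Fin.castPred_inj).1 h)
    simp [Fin.ext_iff] at this
    omega
  let s : Finset (Fin (a + b)) := Finset.univ.image L
  have hs : s.card = a := by
    simp [s, Finset.card_image_of_injective _ hL]
  have hs' := compl_card_aux s hs
  have hLs : ∀ i, L i ∈ s := fun i => by simp [s]
  have hRs : ∀ i, R i ∈ sᶜ := fun i => by
    simp only [s, Finset.mem_compl, Finset.mem_image, not_exists, Finset.mem_univ, true_and]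
    exact fun j => hLR j i
  let t : Fin a → Fin a := fun i => (s.orderIsoOfFin hs).symm ⟨L i, hLs i⟩
  let r : Fin b → Fin b := fun i => Fin.rev ((sᶜ.orderIsoOfFin hs').symm ⟨R i, hRs i⟩)
  have ht : Function.Injective t := by
    intro i j h
    have := (s.orderIsoOfFin hs).symm.injective h
    exact hL (by simpa using this)
  have hr : Function.Injective r := by
    intro i j h
    have := (sᶜ.orderIsoOfFin hs').symm.injective (Fin.rev_injective h)
    exact hR (by simpa using this)
  refine ⟨⟨s, hs⟩, Equiv.ofBijective t (Finite.injective_iff_bijective.1 ht),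
    Equiv.ofBijective r (Finite.injective_iff_bijective.1 hr), ?_⟩
  apply Equiv.ext
  intro i
  rcases lt_trichotomy i.1 a with h | h | h
  · obtain ⟨j, rfl⟩ : ∃ j : Fin a, i = ⟨j.1, by have := j.2; clear * - this; omega⟩ :=
      ⟨⟨i.1, h⟩, rfl⟩
    rw [glue_left]
    simp only [Equiv.ofBijective_apply, t]
    rw [← Finset.coe_orderIsoOfFin_apply, OrderIso.apply_symm_apply]
    simp [L]
  · obtain rfl : i = ⟨a, by clear * -; omega⟩ := Fin.ext h
    rw [glue_mid, hσ]
  · obtain ⟨j, rfl⟩ : ∃ j : Fin b, i = ⟨a + 1 + j.1, by have := j.2; clear * - this; omega⟩ :=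
      ⟨⟨i.1 - a - 1, by omega⟩, Fin.ext (by simp; omega)⟩
    rw [glue_right]
    simp only [Equiv.ofBijective_apply, r, Fin.rev_rev]
    rw [← Finset.coe_orderIsoOfFin_apply, OrderIso.apply_symm_apply]
    simp [R]

theorem permEnt_of {n : ℕ} (σ : Equiv.Perm (Fin n)) (i : ℕ) (h : i < n) :
    permEnt σ (i + 1) = (σ ⟨i, h⟩ : ℕ) + 1 := by
  have : 1 ≤ i + 1 ∧ i + 1 ≤ n := by omega
  simp [permEnt, this]

theorem permEnt_le {n : ℕ} (σ : Equiv.Perm (Fin n)) (i : ℕ) : permEnt σ i ≤ n := by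
  unfold permEnt
  split_ifs
  · omega
  · omega

section
variable {a b : ℕ} (s : {s : Finset (Fin (a + b)) // s.card = a})
    (τ : Equiv.Perm (Fin a)) (ρ : Equiv.Perm (Fin b))

theorem ent_left (i j : ℕ) (hi : 1 ≤ i) (hia : i ≤ a) (hj : 1 ≤ j) (hja : j ≤ a) :
    permEnt (glue s τ ρ) i < permEnt (glue s τ ρ) j ↔ permEnt τ i < permEnt τ j := by
  obtain ⟨i, rfl⟩ := Nat.exists_eq_add_of_le' hi
  obtain ⟨j, rfl⟩ := Nat.exists_eq_add_of_le' hj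
  rw [permEnt_of _ i (by omega), permEnt_of _ j (by omega), permEnt_of _ i (by omega),
    permEnt_of _ j (by omega), glue_left s τ ρ ⟨i, by omega⟩, glue_left s τ ρ ⟨j, by omega⟩]
  simp

theorem ent_right (i j : ℕ) (hi : 1 ≤ i) (hia : i ≤ b) (hj : 1 ≤ j) (hja : j ≤ b) :
    permEnt (glue s τ ρ) (a + 1 + i) < permEnt (glue s τ ρ) (a + 1 + j) ↔
      permEnt ρ j < permEnt ρ i := by
  obtain ⟨i, rfl⟩ := Nat.exists_eq_add_of_le' hi
  obtain ⟨j, rfl⟩ := Nat.exists_eq_add_of_le' hj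
  rw [← add_assoc (a + 1) i 1, ← add_assoc (a + 1) j 1,
    permEnt_of _ (a + 1 + i) (by omega), permEnt_of _ (a + 1 + j) (by omega),
    permEnt_of _ i (by omega),
    permEnt_of _ j (by omega), glue_right s τ ρ ⟨i, by omega⟩, glue_right s τ ρ ⟨j, by omega⟩]
  simp

theorem ent_mid (i : ℕ) (hi : i ≠ a + 1) :
    permEnt (glue s τ ρ) i < permEnt (glue s τ ρ) (a + 1) := by
  rw [permEnt_of _ a (by omega), glue_mid]
  by_cases h : 1 ≤ i ∧ i ≤ a + b + 1
  · obtain ⟨i, rfl⟩ := Nat.exists_eq_add_of_le' h.1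
    rw [permEnt_of _ i (by omega)]
    have h1 : glue s τ ρ ⟨i, by omega⟩ ≠ Fin.last _ := by
      rw [← glue_mid s τ ρ]
      intro h
      have := (glue s τ ρ).injective h
      simp at this
      omega
    have := Fin.lt_last_iff_ne_last.2 h1
    rw [Fin.lt_def] at this
    omega
  · simp [permEnt, h]

theorem good_even (ha : a % 2 = 0) :
    GoodPerm (glue s τ ρ) ↔ GoodPerm τ ∧ GoodPerm ρ := by
  have hl := ent_left s τ ρ
  have hr := ent_right s τ ρ
  have hm := ent_mid s τ ρ
  unfold GoodPerm IsValley IsPeak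
  generalize permEnt (glue s τ ρ) = w at *
  generalize permEnt τ = u at *
  generalize permEnt ρ = v at *
  constructor
  · rintro ⟨hV, hP⟩
    refine ⟨⟨fun i hi => hV i ?_, fun i hi => hP i ?_⟩,
      ⟨fun i hi => ?_, fun i hi => ?_⟩⟩
    · rw [hl _ _ (by omega) (by omega) (by omega) (by omega),
        hl _ _ (by omega) (by omega) (by omega) (by omega)]
      exact ⟨hi.1, by omega, hi.2.2⟩
    · rw [hl _ _ (by omega) (by omega) (by omega) (by omega),
        hl _ _ (by omega) (by omega) (by omega) (by omega)]
      exact ⟨hi.1, by omega, hi.2.2⟩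
    · have := hP (a + 1 + i) (by
        rw [show a + 1 + i - 1 = a + 1 + (i - 1) by omega, add_assoc (a + 1) i 1,
          hr _ _ (by omega) (by omega) (by omega) (by omega),
          hr _ _ (by omega) (by omega) (by omega) (by omega)]
        exact ⟨by omega, by omega, hi.2.2⟩)
      omega
    · have := hV (a + 1 + i) (by
        rw [show a + 1 + i - 1 = a + 1 + (i - 1) by omega, add_assoc (a + 1) i 1,
          hr _ _ (by omega) (by omega) (by omega) (by omega),
          hr _ _ (by omega) (by omega) (by omega) (by omega)]
        exact ⟨by omega, by omega, hi.2.2⟩)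
      omega
  · rintro ⟨⟨hVl, hPl⟩, ⟨hVr, hPr⟩⟩
    refine ⟨fun i hi => ?_, fun i hi => ?_⟩
    · rcases lt_or_ge i a with h | h
      · rw [hl _ _ (by omega) (by omega) (by omega) (by omega),
          hl _ _ (by omega) (by omega) (by omega) (by omega)] at hi
        exact hVl i ⟨hi.1, h, hi.2.2⟩
      · by_cases h1 : i = a + 1
        · subst h1
          have := hm (a + 1 + 1) (by omega)
          omega
        · by_cases h2 : i ≤ a + 2
          · omega
          · obtain ⟨j, rfl⟩ : ∃ j, i = a + 1 + j := ⟨i - (a + 1), by omega⟩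
            rw [show a + 1 + j - 1 = a + 1 + (j - 1) by omega, add_assoc (a + 1) j 1,
              hr _ _ (by omega) (by omega) (by omega) (by omega),
              hr _ _ (by omega) (by omega) (by omega) (by omega)] at hi
            have := hPr j ⟨by omega, by omega, hi.2.2⟩
            omega
    · rcases lt_or_ge i a with h | h
      · rw [hl _ _ (by omega) (by omega) (by omega) (by omega),
          hl _ _ (by omega) (by omega) (by omega) (by omega)] at hi
        exact hPl i ⟨hi.1, h, hi.2.2⟩
      · by_cases h0 : i = a
        · subst h0
          have := hm i (by omega)
          omega
        by_cases h2 : i = a + 2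
        · subst h2
          have := hm (a + 2) (by omega)
          simp only [Nat.add_one_sub_one] at hi
          omega
        by_cases h1 : i = a + 1
        · omega
        · obtain ⟨j, rfl⟩ : ∃ j, i = a + 1 + j := ⟨i - (a + 1), by omega⟩
          rw [show a + 1 + j - 1 = a + 1 + (j - 1) by omega, add_assoc (a + 1) j 1,
            hr _ _ (by omega) (by omega) (by omega) (by omega),
            hr _ _ (by omega) (by omega) (by omega) (by omega)] at hi
          have := hVr j ⟨by omega, by omega, hi.2.2⟩
          omega

theorem good_odd (ha : a % 2 = 1) (hb : 1 ≤ b) : ¬ GoodPerm (glue s τ ρ) := by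
  rintro ⟨-, hP⟩
  have := hP (a + 1) ⟨by omega, by omega, ent_mid s τ ρ _ (by omega),
    ent_mid s τ ρ _ (by omega)⟩
  omega

theorem good_odd_last (ha : a % 2 = 1) (hb : b = 0) :
    GoodPerm (glue s τ ρ) ↔ GoodPerm τ ∧ ¬ IsDescent τ (a - 1) := by
  have hl := ent_left s τ ρ
  have hm := ent_mid s τ ρ
  unfold GoodPerm IsValley IsPeak IsDescent
  generalize permEnt (glue s τ ρ) = w at *
  generalize permEnt τ = u at *
  constructor
  · rintro ⟨hV, hP⟩
    refine ⟨⟨fun i hi => hV i ?_, fun i hi => hP i ?_⟩, fun hd => ?_⟩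
    · rw [hl _ _ (by omega) (by omega) (by omega) (by omega),
        hl _ _ (by omega) (by omega) (by omega) (by omega)]
      exact ⟨hi.1, by omega, hi.2.2⟩
    · rw [hl _ _ (by omega) (by omega) (by omega) (by omega),
        hl _ _ (by omega) (by omega) (by omega) (by omega)]
      exact ⟨hi.1, by omega, hi.2.2⟩
    · have h2 := hd.2.2
      rw [show a - 1 + 1 = a by omega] at h2
      have := hV a ⟨by omega, by omega,
        (hl _ _ (by omega) (by omega) (by omega) (by omega)).2 h2, hm _ (by omega)⟩
      omega
  · rintro ⟨⟨hVl, hPl⟩, hd⟩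
    refine ⟨fun i hi => ?_, fun i hi => ?_⟩
    · rcases lt_or_ge i a with h | h
      · rw [hl _ _ (by omega) (by omega) (by omega) (by omega),
          hl _ _ (by omega) (by omega) (by omega) (by omega)] at hi
        exact hVl i ⟨hi.1, h, hi.2.2⟩
      · obtain rfl : i = a := by omega
        exfalso
        apply hd
        refine ⟨by omega, by omega, ?_⟩
        rw [show i - 1 + 1 = i by omega]
        exact (hl _ _ (by omega) (by omega) (by omega) (by omega)).1 hi.2.2.1
    · rcases lt_or_ge i a with h | h
      · rw [hl _ _ (by omega) (by omega) (by omega) (by omega),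
          hl _ _ (by omega) (by omega) (by omega) (by omega)] at hi
        exact hPl i ⟨hi.1, h, hi.2.2⟩
      · omega
end

theorem count_glue {a b : ℕ} (P : Equiv.Perm (Fin a) → Prop) (Q : Equiv.Perm (Fin b) → Prop)
    (h : ∀ s τ ρ, GoodPerm (glue (a := a) (b := b) s τ ρ) ↔ P τ ∧ Q ρ) :
    Nat.card {σ : Equiv.Perm (Fin (a + b + 1)) // GoodPerm σ ∧ σ ⟨a, by omega⟩ = Fin.last _} =
      (a + b).choose a * Nat.card {τ // P τ} * Nat.card {ρ // Q ρ} := by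
  have hc : (a + b).choose a = Nat.card {s : Finset (Fin (a + b)) // s.card = a} := by
    rw [Nat.card_eq_fintype_card, Fintype.card_finset_len, Fintype.card_fin]
  rw [hc, ← Nat.card_prod, ← Nat.card_prod]
  symm
  refine Nat.card_eq_of_bijective (fun x => ⟨glue x.1.1 x.1.2.1 x.2.1,
    (h _ _ _).2 ⟨x.1.2.2, x.2.2⟩, glue_mid _ _ _⟩) ⟨?_, ?_⟩
  · rintro ⟨⟨s, τ, hτ⟩, ρ, hρ⟩ ⟨⟨s', τ', hτ'⟩, ρ', hρ'⟩ hx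
    obtain ⟨rfl, rfl, rfl⟩ := glue_inj _ _ _ _ _ _ (Subtype.mk.inj hx)
    rfl
  · rintro ⟨σ, hg, hσ⟩
    obtain ⟨s, τ, ρ, rfl⟩ := glue_surj σ hσ
    have := (h _ _ _).1 hg
    exact ⟨⟨⟨s, τ, this.1⟩, ρ, this.2⟩, rfl⟩

theorem sum_even_aux (h : ℕ → ℕ) (n : ℕ) :
    ∑ a ∈ Finset.range n, (if a % 2 = 0 then h a else 0) =
      ∑ k ∈ Finset.range ((n + 1) / 2), h (2 * k) := by
  induction n with
  | zero => simp
  | succ n ih =>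
    rw [Finset.sum_range_succ, ih]
    split_ifs with hn
    · rw [show (n + 1 + 1) / 2 = (n + 1) / 2 + 1 by omega, Finset.sum_range_succ,
        show 2 * ((n + 1) / 2) = n by omega]
    · rw [show (n + 1 + 1) / 2 = (n + 1) / 2 by omega, add_zero]

theorem fCount_zero : fCount 0 = 1 := by
  unfold fCount
  rw [Nat.card_eq_one_iff_unique]
  refine ⟨inferInstance, ⟨⟨1, ?_, ?_⟩⟩⟩
  · intro i hi; exact absurd hi.2.1 (by omega)
  · intro i hi; exact absurd hi.2.1 (by omega)

theorem fCount_split (n : ℕ) : fCount (n + 1) = ∑ a : Fin (n + 1),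
    Nat.card {σ : Equiv.Perm (Fin (n + 1)) // GoodPerm σ ∧ σ a = Fin.last _} := by
  rw [← Nat.card_sigma]
  unfold fCount
  symm
  refine Nat.card_eq_of_bijective (fun x => ⟨x.2.1, x.2.2.1⟩) ⟨?_, ?_⟩
  · rintro ⟨a, σ, hg, ha⟩ ⟨a', σ', hg', ha'⟩ hx
    obtain rfl : σ = σ' := Subtype.mk.inj hx
    obtain rfl : a = a' := σ.injective (ha.trans ha'.symm)
    rfl
  · rintro ⟨σ, hg⟩
    exact ⟨⟨σ.symm (Fin.last _), σ, hg, by simp⟩, rfl⟩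

theorem term_lt (n a : ℕ) (ha : a < n) :
    Nat.card {σ : Equiv.Perm (Fin (n + 1)) // GoodPerm σ ∧ σ ⟨a, by omega⟩ = Fin.last _} =
      if a % 2 = 0 then n.choose a * fCount a * fCount (n - a) else 0 := by
  obtain ⟨b, rfl⟩ := Nat.exists_eq_add_of_lt ha
  rw [show a + b + 1 - a = b + 1 by omega]
  split_ifs with h
  · exact count_glue (a := a) (b := b + 1) _ _ (fun s τ ρ => good_even s τ ρ h)
  · have := count_glue (a := a) (b := b + 1) (fun _ => False) (fun _ => False)
      (fun s τ ρ => by simpa using good_odd s τ ρ (by omega) (by omega))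
    rw [show (0 : ℕ) = (a + (b + 1)).choose a * Nat.card {τ : Equiv.Perm (Fin a) // False} *
      Nat.card {τ : Equiv.Perm (Fin (b + 1)) // False} by simp]
    exact this

theorem term_last (n : ℕ) :
    Nat.card {σ : Equiv.Perm (Fin (n + 1)) // GoodPerm σ ∧ σ (Fin.last n) = Fin.last _} =
      if Even n then fCount n else gCount n := by
  split_ifs with h
  · have := count_glue (a := n) (b := 0) _ _
      (fun s τ ρ => good_even s τ ρ (Nat.even_iff.1 h))
    change _ = _ * fCount n * fCount 0 at this
    rw [fCount_zero] at this
    refine Eq.trans ?_ (this.trans (by simp))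
    rfl
  · have := count_glue (a := n) (b := 0) _ (fun _ => True)
      (fun s τ ρ => by rw [good_odd_last s τ ρ (Nat.not_even_iff.1 h) rfl, and_true])
    change _ = _ * gCount n * _ at this
    refine Eq.trans ?_ (this.trans (by simp))
    rfl

/-- the recurrence for `f`. -/
theorem statement1 (n : ℕ) :
    fCount (n + 1) =
      (∑ k ∈ Finset.range ((n + 1) / 2),
        n.choose (2 * k) * fCount (2 * k) * fCount (n - 2 * k)) +
      (if Even n then fCount n else gCount n) := by
  rw [fCount_split, Fin.sum_univ_castSucc, term_last,
    ← sum_even_aux (fun a => n.choose a * fCount a * fCount (n - a)), Finset.sum_range]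
  congr 1
  exact Finset.sum_congr rfl (fun a _ => term_lt n a.1 a.2)
end

section
/- For every real x with |x| < 1, the series Σ_{n=0}^∞ f(n)·xⁿ/n! converges absolutely and (3·cos(x/2) − √3·sinh(√3·x/2)) · Σ_{n=0}^∞ f(n)·xⁿ/n! = 3·sin(x/2) + 3·cosh(√3·x/2). -/
def GoodL : Bool → List ℕ → Prop
  | b, x :: y :: z :: t =>
      ((x < y ∧ z < y) → b = true) ∧ ((y < x ∧ y < z) → b = false) ∧ GoodL (!b) (y :: z :: t)
  | _, _ => True

def ZL (r : ℕ → ℕ → Prop) : List ℕ → Prop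
  | [] => True
  | [_] => False
  | [x, y] => r y x
  | _ :: y :: z :: t => ZL r (y :: z :: t)

def parF (b : Bool) : List ℕ → Bool
  | [] => b
  | _ :: t => parF (!b) t

theorem parF_eq (b : Bool) (l : List ℕ) : parF b l = if l.length % 2 = 0 then b else !b := by
  induction l generalizing b with
  | nil => simp [parF]
  | cons a t ih =>
    simp only [parF, ih, List.length_cons]
    rcases Nat.mod_two_eq_zero_or_one t.length with h | h
    · have : (t.length + 1) % 2 = 1 := by omega
      simp [h, this]
    · have : (t.length + 1) % 2 = 0 := by omega
      simp [h, this]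

/-- splitting at an allowed peak -/
theorem GoodL_split_even (m : ℕ) (l2 : List ℕ) (h2 : ∀ a ∈ l2, a < m) :
    ∀ (l1 : List ℕ) (b : Bool), (∀ a ∈ l1, a < m) → parF b l1 = false →
      (GoodL b (l1 ++ m :: l2) ↔ GoodL b l1 ∧ GoodL true l2)
  | [], b, _, hb => by
    simp only [parF] at hb
    subst hb
    match l2, h2 with
    | [], _ => simp [GoodL]
    | [y], _ => simp [GoodL]
    | y :: z :: t, h2 =>
      have : y < m := h2 y (by simp)
      simp [GoodL, this, not_lt.mpr this.le]
  | [x], b, h1, hb => by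
    have hx : x < m := h1 x (by simp)
    simp only [parF, Bool.not_eq_false'] at hb
    subst hb
    have ih := GoodL_split_even m l2 h2 [] false (by simp) (by simp [parF])
    match l2, h2, ih with
    | [], _, _ => simp [GoodL]
    | y :: t, h2, ih =>
      have hy : y < m := h2 y (by simp)
      simp only [List.nil_append] at ih
      simp only [List.cons_append, List.nil_append]
      rw [GoodL]
      simp [GoodL, ih, not_lt.mpr hx.le]
  | [x, y], b, h1, hb => by
    have hx : x < m := h1 x (by simp)
    have hy : y < m := h1 y (by simp)
    simp only [parF, Bool.not_not] at hb
    subst hb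
    have ih := GoodL_split_even m l2 h2 [y] true (by simp [hy]) (by simp [parF])
    simp only [List.cons_append, List.nil_append] at ih ⊢
    rw [GoodL]
    simp [GoodL, ih, not_lt.mpr hy.le]
  | x :: y :: z :: t, b, h1, hb => by
    have ih := GoodL_split_even m l2 h2 (y :: z :: t) (!b)
      (fun a ha => h1 a (List.mem_cons_of_mem _ ha)) hb
    simp only [List.cons_append] at ih ⊢
    rw [GoodL, ih]
    conv_rhs => rw [GoodL]
    tauto

theorem GoodL_split_odd (m : ℕ) (c : ℕ) (l2 : List ℕ) (hc : c < m) :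
    ∀ (l1 : List ℕ) (b : Bool), (∀ a ∈ l1, a < m) → parF b l1 = true → l1 ≠ [] →
      ¬ (GoodL b (l1 ++ m :: c :: l2))
  | [], b, _, hb, hn => by simp at hn
  | [x], b, h1, hb, _ => by
    have hx : x < m := h1 x (by simp)
    simp only [parF, Bool.not_eq_true'] at hb
    subst hb
    simp [GoodL, hx, hc]
  | x :: y :: t, b, h1, hb, _ => by
    have ih := GoodL_split_odd m c l2 hc (y :: t) (!b)
      (fun a ha => h1 a (List.mem_cons_of_mem _ ha)) hb (by simp)
    cases t with
    | nil => 
      simp only [List.cons_append, List.nil_append] at ih ⊢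
      rw [GoodL]; tauto
    | cons z t => 
      simp only [List.cons_append, List.nil_append] at ih ⊢
      rw [GoodL]; tauto

theorem GoodL_snoc_odd (m : ℕ) :
    ∀ (l1 : List ℕ) (b : Bool), (∀ a ∈ l1, a < m) → parF b l1 = true → l1 ≠ [] →
      (GoodL b (l1 ++ [m]) ↔ GoodL b l1 ∧ ¬ ZL (· < ·) l1)
  | [], b, _, hb, hn => by simp at hn
  | [x], b, h1, hb, _ => by
    simp [GoodL, ZL]
  | [x, y], b, h1, hb, _ => by
    have hy : y < m := h1 y (by simp)
    simp only [parF, Bool.not_not] at hb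
    subst hb
    simp [GoodL, ZL, hy]
  | x :: y :: z :: t, b, h1, hb, _ => by
    have ih := GoodL_snoc_odd m (y :: z :: t) (!b)
      (fun a ha => h1 a (List.mem_cons_of_mem _ ha)) hb (by simp)
    simp only [List.cons_append] at ih ⊢
    rw [GoodL, ih]
    conv_rhs => rw [GoodL, ZL]
    tauto

theorem ZL_split (m : ℕ) (l2 : List ℕ) (h2 : ∀ a ∈ l2, a < m) (hnd : l2.Nodup) :
    ∀ (l1 : List ℕ), (∀ a ∈ l1, a < m) →
      (¬ ZL (· < ·) (l1 ++ m :: l2) ↔ ZL (· > ·) l2)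
  | [], _ => by
    match l2, h2, hnd with
    | [], _, _ => simp [ZL]
    | [y], h2, _ => 
      have : y < m := h2 y (by simp)
      simp [ZL, this]
    | y :: z :: t, h2, hnd =>
      simp only [List.nil_append]
      rw [ZL]
      clear h2
      induction t generalizing y z with
      | nil => 
        simp [ZL] at hnd ⊢
        omega
      | cons w t ih => 
        have := ih z w (List.nodup_cons.mp hnd).2
        simpa only [ZL] using this
  | [x], h1 => by
    have ih := ZL_split m l2 h2 hnd [] (by simp)
    have hx : x < m := h1 x (by simp)
    match l2, ih with
    | [], _ => simp [ZL, hx.le]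
    | y :: t, ih =>
      rw [← ih]
      simp [ZL]
  | x :: y :: t, h1 => by
    have ih := ZL_split m l2 h2 hnd (y :: t)
      (fun a ha => h1 a (List.mem_cons_of_mem _ ha))
    rw [← ih]
    cases t <;> simp [ZL]

theorem GoodL_map_mono (φ : ℕ → ℕ) (s : Set ℕ) (hφ : StrictMonoOn φ s) :
    ∀ (b : Bool) (l : List ℕ), (∀ a ∈ l, a ∈ s) → (GoodL b (l.map φ) ↔ GoodL b l)
  | b, [], _ => by simp [GoodL]
  | b, [x], _ => by simp [GoodL]
  | b, [x, y], _ => by simp [GoodL]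
  | b, x :: y :: z :: t, h => by
    have ih := GoodL_map_mono φ s hφ (!b) (y :: z :: t) (fun a ha => h a (List.mem_cons_of_mem _ ha))
    have hx := h x (by simp)
    have hy := h y (by simp)
    have hz := h z (by simp)
    simp only [List.map_cons] at ih ⊢
    rw [GoodL, ih, GoodL, hφ.lt_iff_lt hx hy, hφ.lt_iff_lt hz hy, hφ.lt_iff_lt hy hx, hφ.lt_iff_lt hy hz]

theorem GoodL_map_anti (φ : ℕ → ℕ) (s : Set ℕ) (hφ : StrictAntiOn φ s) :
    ∀ (b : Bool) (l : List ℕ), (∀ a ∈ l, a ∈ s) → (GoodL b (l.map φ) ↔ GoodL (!b) l)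
  | b, [], _ => by simp [GoodL]
  | b, [x], _ => by simp [GoodL]
  | b, [x, y], _ => by simp [GoodL]
  | b, x :: y :: z :: t, h => by
    have ih := GoodL_map_anti φ s hφ (!b) (y :: z :: t) (fun a ha => h a (List.mem_cons_of_mem _ ha))
    have hx := h x (by simp)
    have hy := h y (by simp)
    have hz := h z (by simp)
    simp only [List.map_cons] at ih ⊢
    rw [GoodL, ih, GoodL, hφ.lt_iff_gt hx hy, hφ.lt_iff_gt hz hy, hφ.lt_iff_gt hy hx, hφ.lt_iff_gt hy hz]
    cases b <;> simp

theorem ZL_map (φ : ℕ → ℕ) (s : Set ℕ) (r r' : ℕ → ℕ → Prop)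
    (hφ : ∀ x ∈ s, ∀ y ∈ s, (r (φ x) (φ y) ↔ r' x y)) :
    ∀ (l : List ℕ), (∀ a ∈ l, a ∈ s) → (ZL r (l.map φ) ↔ ZL r' l)
  | [], _ => by simp [ZL]
  | [x], _ => by simp [ZL]
  | [x, y], h => by
    have hx := h x (by simp)
    have hy := h y (by simp)
    simp [ZL, hφ y hy x hx]
  | x :: y :: z :: t, h => by
    have ih := ZL_map φ s r r' hφ (y :: z :: t) (fun a ha => h a (List.mem_cons_of_mem _ ha))
    simp only [List.map_cons] at ih ⊢
    rw [ZL, ih, ZL]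

/-! counting -/
noncomputable def LS (s : Finset ℕ) : Finset (List ℕ) := s.val.lists.toFinset

theorem mem_LS (s : Finset ℕ) (l : List ℕ) : l ∈ LS s ↔ s.val = (l : Multiset ℕ) := by
  rw [LS, Multiset.mem_toFinset, Multiset.mem_lists_iff]; rfl

open Classical in
noncomputable def cnt (P : List ℕ → Prop) (s : Finset ℕ) : ℕ :=
  ((LS s).filter P).card

theorem mem_lists' (s : Finset ℕ) (l : List ℕ) : l ∈ (LS s) ↔ l.Nodup ∧ ∀ a, a ∈ l ↔ a ∈ s := by
  rw [mem_LS]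
  constructor
  · intro h
    have h1 : (l : Multiset ℕ).Nodup := h ▸ s.nodup
    refine ⟨by simpa using h1, fun a => ?_⟩
    rw [← Finset.mem_val, h]; simp
  · rintro ⟨h1, h2⟩
    rw [Multiset.Nodup.ext s.nodup (by simpa using h1)]
    intro a
    simp [h2]

theorem cnt_map (φ : ℕ → ℕ) (s : Finset ℕ) (hφ : Set.InjOn φ s) (P Q : List ℕ → Prop)
    (h : ∀ l : List ℕ, (∀ a ∈ l, a ∈ (s : Set ℕ)) → (P (l.map φ) ↔ Q l)) :
    cnt Q s = cnt P (s.image φ) := by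
  classical
  unfold cnt
  apply Finset.card_bij (fun l _ => l.map φ)
  · intro l hl
    simp only [Finset.mem_filter, mem_lists'] at hl ⊢
    obtain ⟨⟨h1, h2⟩, h3⟩ := hl
    refine ⟨⟨?_, ?_⟩, ?_⟩
    · apply List.Nodup.map_on _ h1
      intro x hx y hy hxy
      exact hφ ((h2 x).1 hx) ((h2 y).1 hy) hxy
    · intro a; simp [h2]
    · exact (h l (fun a ha => (h2 a).1 ha)).2 h3
  · intro l hl l' hl' he
    simp only [Finset.mem_filter, mem_lists'] at hl hl'
    obtain ⟨⟨h1, h2⟩, h3⟩ := hl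
    obtain ⟨⟨h1', h2'⟩, h3'⟩ := hl'
    clear h1 h1' h3 h3'
    replace h2 := fun a ha => (h2 a).1 ha
    replace h2' := fun a ha => (h2' a).1 ha
    induction l generalizing l' with
    | nil => simpa [eq_comm] using he
    | cons c u ih =>
      cases l' with
      | nil => simp at he
      | cons d v =>
        simp only [List.map_cons, List.cons.injEq] at he
        rw [hφ (h2 c (by simp)) (h2' d (by simp)) he.1]
        rw [ih v he.2 (fun a ha => h2 a (List.mem_cons_of_mem _ ha))
          (fun a ha => h2' a (List.mem_cons_of_mem _ ha))]
  · intro l hl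
    simp only [Finset.mem_filter, mem_lists'] at hl
    obtain ⟨⟨h1, h2⟩, h3⟩ := hl
    have : ∀ a ∈ l, ∃ x ∈ s, φ x = a := by
      intro a ha
      simpa using (h2 a).1 ha
    choose! ψ hψ using this
    have hm : (l.map ψ).map φ = l := by
      rw [List.map_map]
      conv_rhs => rw [← List.map_id l]
      apply List.map_congr_left
      intro a ha
      simp [(hψ a ha).2]
    refine ⟨l.map ψ, ?_, hm⟩
    simp only [Finset.mem_filter, mem_lists']
    have hmem : ∀ a ∈ l.map ψ, a ∈ (s : Set ℕ) := by
      intro a ha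
      rw [List.mem_map] at ha
      obtain ⟨c, hc, rfl⟩ := ha
      exact (hψ c hc).1
    refine ⟨⟨List.Nodup.of_map φ (hm.symm ▸ h1), ?_⟩, ?_⟩
    · intro a
      refine ⟨hmem a, fun ha => ?_⟩
      have : φ a ∈ l := (h2 _).2 (Finset.mem_image_of_mem _ ha)
      rw [List.mem_map]
      exact ⟨φ a, this, hφ (hψ _ this).1 ha (hψ _ this).2⟩
    · rw [← h _ hmem, hm]; exact h3

theorem exists_mono (s : Finset ℕ) : ∃ φ : ℕ → ℕ, StrictMonoOn φ s ∧ s.image φ = Finset.range s.card := by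
  classical
  have hm : StrictMonoOn (fun x => (s.filter (· < x)).card) (s : Set ℕ) := by
    intro x hx y hy hxy
    apply Finset.card_lt_card
    rw [Finset.ssubset_iff_of_subset]
    · exact ⟨x, by simp [hxy]; exact hx, by simp⟩
    · intro a; simp only [Finset.mem_filter]; intro h; exact ⟨h.1, h.2.trans hxy⟩
  refine ⟨_, hm, ?_⟩
  apply Finset.eq_of_subset_of_card_le
  · intro a
    simp only [Finset.mem_image, Finset.mem_range]
    rintro ⟨x, hx, rfl⟩
    apply Finset.card_lt_card
    rw [Finset.ssubset_iff_of_subset (Finset.filter_subset _ _)]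
    exact ⟨x, hx, by simp⟩
  · rw [Finset.card_image_of_injOn hm.injOn, Finset.card_range]

theorem exists_anti (s : Finset ℕ) : ∃ φ : ℕ → ℕ, StrictAntiOn φ s ∧ s.image φ = Finset.range s.card := by
  classical
  have hm : StrictAntiOn (fun x => (s.filter (x < ·)).card) (s : Set ℕ) := by
    intro x hx y hy hxy
    apply Finset.card_lt_card
    rw [Finset.ssubset_iff_of_subset]
    · exact ⟨y, by simp [hxy]; exact hy, by simp⟩
    · intro a; simp only [Finset.mem_filter]; intro h; exact ⟨h.1, hxy.trans h.2⟩
  refine ⟨_, hm, ?_⟩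
  apply Finset.eq_of_subset_of_card_le
  · intro a
    simp only [Finset.mem_image, Finset.mem_range]
    rintro ⟨x, hx, rfl⟩
    apply Finset.card_lt_card
    rw [Finset.ssubset_iff_of_subset (Finset.filter_subset _ _)]
    exact ⟨x, hx, by simp⟩
  · rw [Finset.card_image_of_injOn hm.injOn, Finset.card_range]

noncomputable def fN (n : ℕ) : ℕ := cnt (GoodL false) (Finset.range n)
noncomputable def gN (n : ℕ) : ℕ := cnt (fun l => GoodL false l ∧ ¬ ZL (· < ·) l) (Finset.range n)
noncomputable def hN (n : ℕ) : ℕ := cnt (fun l => GoodL false l ∧ ZL (· < ·) l) (Finset.range n)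

theorem fN_eq (n : ℕ) : fN n = gN n + hN n := by
  classical
  unfold fN gN hN cnt
  rw [← Finset.card_union_of_disjoint]
  · congr 1
    ext l
    simp only [Finset.mem_filter, Finset.mem_union]
    tauto
  · rw [Finset.disjoint_left]
    intro l
    simp only [Finset.mem_filter]
    tauto

theorem cnt_f (s : Finset ℕ) : cnt (GoodL false) s = fN s.card := by
  obtain ⟨φ, h1, h2⟩ := exists_mono s
  rw [fN, ← h2]
  exact cnt_map φ s h1.injOn _ _ (fun l hl => GoodL_map_mono φ s h1 _ l hl)

theorem cnt_g (s : Finset ℕ) : cnt (fun l => GoodL false l ∧ ¬ ZL (· < ·) l) s = gN s.card := by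
  obtain ⟨φ, h1, h2⟩ := exists_mono s
  rw [gN, ← h2]
  refine cnt_map φ s h1.injOn _ _ (fun l hl => ?_)
  rw [GoodL_map_mono φ s h1 _ l hl, ZL_map φ s _ (· < ·) (fun x hx y hy => h1.lt_iff_lt hx hy) l hl]

theorem cnt_ft (s : Finset ℕ) : cnt (GoodL true) s = fN s.card := by
  obtain ⟨φ, h1, h2⟩ := exists_anti s
  rw [fN, ← h2]
  exact cnt_map φ s h1.injOn _ _ (fun l hl => GoodL_map_anti φ s h1 _ l hl)

theorem cnt_ht (s : Finset ℕ) : cnt (fun l => GoodL true l ∧ ZL (· > ·) l) s = hN s.card := by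
  obtain ⟨φ, h1, h2⟩ := exists_anti s
  rw [hN, ← h2]
  refine cnt_map φ s h1.injOn _ _ (fun l hl => ?_)
  rw [GoodL_map_anti φ s h1 _ l hl, ZL_map φ s _ (· > ·) (fun x hx y hy => h1.lt_iff_gt hx hy) l hl]
  rfl

open Classical in
theorem cnt_split (P : List ℕ → Prop) (n : ℕ) :
    cnt P (Finset.range (n + 1)) = ∑ T ∈ (Finset.range n).powerset,
      (((LS T) ×ˢ (LS (Finset.range n \ T))).filter
        (fun p => P (p.1 ++ n :: p.2))).card := by
  rw [cnt, ← Finset.card_sigma]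
  symm
  apply Finset.card_bij (fun (p : (_ : Finset ℕ) × (List ℕ × List ℕ)) _ => p.2.1 ++ n :: p.2.2)
  · rintro ⟨T, l1, l2⟩ h
    simp only [Finset.mem_sigma, Finset.mem_powerset, Finset.mem_filter, Finset.mem_product,
      mem_lists', Finset.mem_sdiff] at h ⊢
    obtain ⟨hT, ⟨⟨h1, h1'⟩, h2, h2'⟩, hP⟩ := h
    have hT' : ∀ a ∈ T, a < n := fun a ha => by simpa using hT ha
    refine ⟨⟨?_, ?_⟩, hP⟩
    · rw [List.nodup_append, List.nodup_cons]
      refine ⟨h1, ⟨?_, h2⟩, ?_⟩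
      · simp [h2']
      · intro a ha b hb
        rw [h1'] at ha
        have := hT' a ha
        rw [List.mem_cons, h2'] at hb
        rintro rfl
        rcases hb with rfl | hb
        · omega
        · exact hb.2 ha
    · intro a
      simp only [List.mem_append, List.mem_cons, h1', h2', Finset.mem_range]
      constructor
      · rintro (h | h | h)
        · have := hT' a h; omega
        · omega
        · omega
      · intro h
        by_cases haT : a ∈ T
        · simp [haT]
        · simp [haT]; omega
  · rintro ⟨T, l1, l2⟩ h ⟨T', l1', l2'⟩ h' he
    simp only [Finset.mem_sigma, Finset.mem_powerset, Finset.mem_filter, Finset.mem_product,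
      mem_lists', Finset.mem_sdiff] at h h' he
    obtain ⟨hT, ⟨⟨h1, h1'⟩, h2, h2'⟩, hP⟩ := h
    obtain ⟨hT', ⟨⟨k1, k1'⟩, k2, k2'⟩, hP'⟩ := h'
    have hn1 : n ∉ l1 := by rw [h1']; intro h; simpa using hT h
    have hn1' : n ∉ l1' := by rw [k1']; intro h; simpa using hT' h
    have key : l1 = l1' ∧ l2 = l2' := by
      clear h1 h1' h2 h2' hP k1 k1' k2 k2' hP'
      induction l1 generalizing l1' with
      | nil =>
        cases l1' with
        | nil => simpa using he
        | cons a t => simp at he hn1'; tauto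
      | cons c u ih =>
        cases l1' with
        | nil => simp at he hn1; exact absurd he.1.symm hn1.1
        | cons a t =>
          simp at he hn1 hn1'
          have := ih t he.2 hn1.2 hn1'.2
          simp [he.1, this]
    obtain ⟨rfl, rfl⟩ := key
    have : T = T' := by ext a; rw [← h1', ← k1']
    subst this; rfl
  · intro l hl
    simp only [Finset.mem_filter, mem_lists'] at hl
    obtain ⟨⟨h1, h2⟩, h3⟩ := hl
    have : n ∈ l := (h2 n).2 (by simp)
    obtain ⟨l1, l2, rfl⟩ := List.append_of_mem this
    rw [List.nodup_append, List.nodup_cons] at h1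
    obtain ⟨n1, ⟨n2, n3⟩, n4⟩ := h1
    refine ⟨⟨l1.toFinset, l1, l2⟩, ?_, rfl⟩
    have hl1 : ∀ a ∈ l1, a < n := by
      intro a ha
      have e1 := n4 a ha n (by simp)
      have := (h2 a).1 (by simp [ha])
      simp at this; omega
    simp only [Finset.mem_sigma, Finset.mem_powerset, Finset.mem_filter, Finset.mem_product,
      mem_lists', Finset.mem_sdiff, List.mem_toFinset]
    refine ⟨fun a ha => by simpa using hl1 a (by simpa using ha), ⟨⟨n1, by simp⟩, n3, ?_⟩, h3⟩
    intro a
    constructor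
    · intro ha
      have := (h2 a).1 (by simp [ha])
      have hne : a ≠ n := by rintro rfl; exact n2 ha
      refine ⟨by simp at this ⊢; omega, fun h => n4 a h a (by simp [ha]) rfl⟩
    · rintro ⟨ha, hb⟩
      have ha' : a < n := by simpa using ha
      have := (h2 a).2 (by simp; omega)
      simp [hb] at this
      rcases this with rfl | h
      · omega
      · exact h

open Classical in
theorem card_prod (A B : List ℕ → Prop) (S T : Finset ℕ) :
    (((LS S) ×ˢ (LS T)).filter (fun p => A p.1 ∧ B p.2)).card = cnt A S * cnt B T := by
  rw [Finset.filter_product, Finset.card_product]; rfl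

theorem sum_powerset_range (n : ℕ) (u : ℕ → ℕ) :
    ∑ T ∈ (Finset.range n).powerset, u T.card = ∑ k ∈ Finset.range (n + 1), n.choose k * u k := by
  rw [Finset.sum_powerset_apply_card]; simp

open Classical in
theorem rec_gen (P B : List ℕ → Prop) (w : ℕ → ℕ) (n : ℕ)
    (hB : ∀ s, cnt B s = w s.card)
    (hPe : ∀ l1 l2 : List ℕ, (∀ a ∈ l1, a < n) → (∀ a ∈ l2, a < n) → l2.Nodup → l1.length % 2 = 0 →
      (P (l1 ++ n :: l2) ↔ GoodL false l1 ∧ B l2))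
    (hPo : ∀ l1 l2 : List ℕ, (∀ a ∈ l1, a < n) → (∀ a ∈ l2, a < n) → l2.Nodup → l1.length % 2 = 1 →
      (P (l1 ++ n :: l2) ↔ (GoodL false l1 ∧ ¬ ZL (· < ·) l1) ∧ l2 = [])) :
    cnt P (Finset.range (n + 1)) =
      ∑ k ∈ Finset.range (n + 1), n.choose k * (if k % 2 = 0 then fN k * w (n - k) else
        if k = n then gN n else 0) := by
  rw [cnt_split, ← sum_powerset_range n (fun k => if k % 2 = 0 then fN k * w (n - k) else
        if k = n then gN n else 0)]
  apply Finset.sum_congr rfl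
  intro T hT
  rw [Finset.mem_powerset] at hT
  have hlt : ∀ l ∈ (LS T), (∀ a ∈ l, a < n) ∧ l.length = T.card := by
    intro l hl
    have hl' := hl
    rw [mem_lists'] at hl
    refine ⟨fun a ha => by simpa using hT ((hl.2 a).1 ha), ?_⟩
    rw [mem_LS] at hl'
    rw [Finset.card_def, hl']; simp
  have hlt2 : ∀ l ∈ (LS (Finset.range n \ T)), (∀ a ∈ l, a < n) ∧ l.Nodup := by
    intro l hl
    rw [mem_lists'] at hl
    refine ⟨fun a ha => ?_, hl.1⟩
    have := (hl.2 a).1 ha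
    simp at this; exact this.1
  have hc : (Finset.range n \ T).card = n - T.card := by
    rw [Finset.card_sdiff_of_subset hT]; simp
  by_cases he : T.card % 2 = 0
  · rw [if_pos he, ← cnt_f, ← hc, ← hB, ← card_prod]
    congr 1
    ext ⟨l1, l2⟩
    simp only [Finset.mem_filter]
    apply and_congr_right
    intro h
    rw [Finset.mem_product] at h
    obtain ⟨a1, a2⟩ := hlt l1 h.1
    obtain ⟨b1, b2⟩ := hlt2 l2 h.2
    exact hPe l1 l2 a1 b1 b2 (by rw [a2]; exact he)
  · rw [if_neg he]
    have : (((LS T) ×ˢ (LS (Finset.range n \ T))).filter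
        (fun p => P (p.1 ++ n :: p.2))).card = gN T.card * cnt (fun l => l = []) (Finset.range n \ T) := by
      rw [← cnt_g, ← card_prod]
      congr 1
      ext ⟨l1, l2⟩
      simp only [Finset.mem_filter]
      apply and_congr_right
      intro h
      rw [Finset.mem_product] at h
      obtain ⟨a1, a2⟩ := hlt l1 h.1
      obtain ⟨b1, b2⟩ := hlt2 l2 h.2
      exact hPo l1 l2 a1 b1 b2 (by rw [a2]; omega)
    rw [this]
    by_cases hTn : T.card = n
    · have : Finset.range n \ T = ∅ := by rw [← Finset.card_eq_zero, hc]; omega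
      rw [this, if_pos hTn, hTn]
      have : cnt (fun l => l = []) ∅ = 1 := by
        rw [cnt, Finset.card_eq_one]
        refine ⟨[], ?_⟩
        ext l
        simp only [Finset.mem_filter, mem_lists', Finset.mem_singleton]
        constructor
        · exact fun h => h.2
        · rintro rfl; simp
      rw [this, mul_one]
    · rw [if_neg hTn]
      have : cnt (fun l => l = []) (Finset.range n \ T) = 0 := by
        rw [cnt, Finset.card_eq_zero, Finset.eq_empty_iff_forall_notMem]
        intro l hl
        simp only [Finset.mem_filter] at hl
        obtain ⟨hl, rfl⟩ := hl
        rw [mem_LS] at hl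
        have h0 : (Finset.range n \ T).card = 0 := by rw [Finset.card_def, hl]; simp
        have := Finset.card_le_card hT
        simp at this
        omega
      rw [this, mul_zero]

theorem par_even {l : List ℕ} (h : l.length % 2 = 0) : parF false l = false := by
  rw [parF_eq, if_pos h]
theorem par_odd {l : List ℕ} (h : l.length % 2 = 1) : parF false l = true := by
  rw [parF_eq, if_neg (by omega)]; rfl

theorem GoodL_odd_aux (n : ℕ) (l1 l2 : List ℕ) (h1 : ∀ a ∈ l1, a < n) (h2 : ∀ a ∈ l2, a < n)
    (h : l1.length % 2 = 1) :
    GoodL false (l1 ++ n :: l2) ↔ (GoodL false l1 ∧ ¬ ZL (· < ·) l1) ∧ l2 = [] := by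
  have hne : l1 ≠ [] := by rintro rfl; simp at h
  cases l2 with
  | nil => simp [GoodL_snoc_odd n l1 false h1 (par_odd h) hne]
  | cons c t =>
    simpa using GoodL_split_odd n c t (h2 c (by simp)) l1 false h1 (par_odd h) hne

theorem rec_f (n : ℕ) : fN (n + 1) =
      ∑ k ∈ Finset.range (n + 1), n.choose k * (if k % 2 = 0 then fN k * fN (n - k) else
        if k = n then gN n else 0) := by
  apply rec_gen (GoodL false) (GoodL true) fN n cnt_ft
  · intro l1 l2 h1 h2 hd h
    exact GoodL_split_even n l2 h2 l1 false h1 (par_even h)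
  · intro l1 l2 h1 h2 hd h
    exact GoodL_odd_aux n l1 l2 h1 h2 h

theorem rec_g (n : ℕ) : gN (n + 1) =
      ∑ k ∈ Finset.range (n + 1), n.choose k * (if k % 2 = 0 then fN k * hN (n - k) else
        if k = n then gN n else 0) := by
  apply rec_gen (fun l => GoodL false l ∧ ¬ ZL (· < ·) l) (fun l => GoodL true l ∧ ZL (· > ·) l) hN n cnt_ht
  · intro l1 l2 h1 h2 hd h
    rw [GoodL_split_even n l2 h2 l1 false h1 (par_even h), ZL_split n l2 h2 hd l1 h1, and_assoc]
  · intro l1 l2 h1 h2 hd h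
    rw [GoodL_odd_aux n l1 l2 h1 h2 h, ZL_split n l2 h2 hd l1 h1]
    constructor
    · exact fun h => h.1
    · rintro h
      refine ⟨h, ?_⟩
      rw [h.2]; simp [ZL]

theorem fN_zero : fN 0 = 1 := by
  classical
  rw [fN, cnt, Finset.card_eq_one]
  refine ⟨[], ?_⟩
  ext l
  simp only [Finset.mem_filter, mem_lists', Finset.mem_singleton, Finset.range_zero]
  constructor
  · rintro ⟨⟨_, h⟩, _⟩
    rw [List.eq_nil_iff_forall_not_mem]
    intro a ha; simpa using (h a).1 ha
  · rintro rfl; simp [GoodL]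

theorem gN_zero : gN 0 = 0 := by
  classical
  rw [gN, cnt, Finset.card_eq_zero, Finset.eq_empty_iff_forall_notMem]
  intro l hl
  simp only [Finset.mem_filter, mem_lists'] at hl
  obtain ⟨hl, hz⟩ := hl
  have : l = [] := by
    rw [List.eq_nil_iff_forall_not_mem]
    intro a ha; simpa using (hl.2 a).1 ha
  subst this
  simp [ZL] at hz

theorem GoodL_iff : ∀ (b : Bool) (l : List ℕ), GoodL b l ↔ ∀ i, i + 2 < l.length →
    ((l.getD i 0 < l.getD (i + 1) 0 ∧ l.getD (i + 2) 0 < l.getD (i + 1) 0) →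
      (if i % 2 = 0 then b else !b) = true) ∧
    ((l.getD (i + 1) 0 < l.getD i 0 ∧ l.getD (i + 1) 0 < l.getD (i + 2) 0) →
      (if i % 2 = 0 then b else !b) = false)
  | b, [] => by simp [GoodL]
  | b, [x] => by simp [GoodL]
  | b, [x, y] => by simp [GoodL]
  | b, x :: y :: z :: t => by
    have ih := GoodL_iff (!b) (y :: z :: t)
    rw [GoodL, ih]
    constructor
    · rintro ⟨h1, h2, h3⟩ i hi
      cases i with
      | zero => simpa using ⟨fun a b => h1 ⟨a, b⟩, fun a b => h2 ⟨a, b⟩⟩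
      | succ j =>
        have := h3 j (by simp at hi ⊢; omega)
        rcases Nat.mod_two_eq_zero_or_one j with hj | hj
        · have hj' : (j + 1) % 2 = 1 := by omega
          simpa [hj, hj'] using this
        · have hj' : (j + 1) % 2 = 0 := by omega
          simpa [hj, hj'] using this
    · intro h
      have h0 := h 0 (by simp)
      simp at h0
      refine ⟨fun a => h0.1 a.1 a.2, fun a => h0.2 a.1 a.2, fun j hj => ?_⟩
      have := h (j + 1) (by simp at hj ⊢; omega)
      rcases Nat.mod_two_eq_zero_or_one j with hj | hj
      · have hj' : (j + 1) % 2 = 1 := by omega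
        simpa [hj, hj'] using this
      · have hj' : (j + 1) % 2 = 0 := by omega
        simpa [hj, hj'] using this

theorem permEnt_eq {n : ℕ} (σ : Equiv.Perm (Fin n)) (i : ℕ) (hi : i < n) :
    permEnt σ (i + 1) = (List.ofFn (fun j => (σ j : ℕ))).getD i 0 + 1 := by
  rw [permEnt, dif_pos ⟨by omega, by omega⟩, List.getD_eq_getElem _ _ (by simpa using hi)]
  simp

theorem good_iff {n : ℕ} (σ : Equiv.Perm (Fin n)) :
    GoodPerm σ ↔ GoodL false (List.ofFn (fun j => (σ j : ℕ))) := by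
  rw [GoodL_iff]
  simp only [List.length_ofFn]
  constructor
  · rintro ⟨h1, h2⟩ i hi
    have a1 := permEnt_eq σ i (by omega)
    have a2 := permEnt_eq σ (i + 1) (by omega)
    have a3 := permEnt_eq σ (i + 2) (by omega)
    have b1 := h1 (i + 2)
    have b2 := h2 (i + 2)
    simp only [IsValley, IsPeak, show i + 2 - 1 = i + 1 by omega] at b1 b2
    rw [a1, show i + 2 = i + 1 + 1 by omega, a2, show i + 1 + 1 + 1 = i + 2 + 1 by omega, a3] at b1 b2
    constructor
    · intro h
      have := b2 ⟨by omega, by omega, by omega, by omega⟩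
      rw [if_neg (by omega)]; rfl
    · intro h
      have := b1 ⟨by omega, by omega, by omega, by omega⟩
      rw [if_pos (by omega)]
  · intro h
    constructor
    · rintro i ⟨h1, h2, h3, h4⟩
      obtain ⟨j, rfl⟩ : ∃ j, i = j + 2 := ⟨i - 2, by omega⟩
      have a1 := permEnt_eq σ j (by omega)
      have a2 := permEnt_eq σ (j + 1) (by omega)
      have a3 := permEnt_eq σ (j + 2) (by omega)
      simp only [show j + 2 - 1 = j + 1 by omega] at h3 h4
      rw [a1, show j + 2 = j + 1 + 1 by omega, a2] at h3
      rw [show j + 2 + 1 = (j + 2) + 1 by omega, a3, show j + 2 = j + 1 + 1 by omega, a2] at h4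
      have := (h j (by omega)).2 ⟨by omega, by simp only [show j + 1 + 1 = j + 2 by omega] at *; omega⟩
      by_contra hc
      rw [if_neg (by omega)] at this
      simp at this
    · rintro i ⟨h1, h2, h3, h4⟩
      obtain ⟨j, rfl⟩ : ∃ j, i = j + 2 := ⟨i - 2, by omega⟩
      have a1 := permEnt_eq σ j (by omega)
      have a2 := permEnt_eq σ (j + 1) (by omega)
      have a3 := permEnt_eq σ (j + 2) (by omega)
      simp only [show j + 2 - 1 = j + 1 by omega] at h3 h4
      rw [a1, show j + 2 = j + 1 + 1 by omega, a2] at h3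
      rw [show j + 2 + 1 = (j + 2) + 1 by omega, a3, show j + 2 = j + 1 + 1 by omega, a2] at h4
      have := (h j (by omega)).1 ⟨by omega, by simp only [show j + 1 + 1 = j + 2 by omega] at *; omega⟩
      by_contra hc
      rw [if_pos (by omega)] at this
      simp at this

theorem fCount_eq (n : ℕ) : fCount n = fN n := by
  classical
  rw [fCount, fN, cnt, Nat.card_eq_fintype_card, Fintype.card_subtype]
  apply Finset.card_bij (fun σ _ => List.ofFn (fun j => (σ j : ℕ)))
  · intro σ hσ
    simp only [Finset.mem_filter, Finset.mem_univ, true_and, mem_lists'] at hσ ⊢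
    refine ⟨⟨?_, ?_⟩, (good_iff σ).1 hσ⟩
    · rw [List.nodup_ofFn]
      intro a b hab
      exact σ.injective (Fin.ext hab)
    · intro a
      simp only [List.mem_ofFn, Finset.mem_range, Set.mem_range]
      constructor
      · rintro ⟨j, rfl⟩; exact (σ j).2
      · intro ha; exact ⟨σ.symm ⟨a, ha⟩, by simp⟩
  · intro σ _ τ _ h
    have := List.ofFn_injective h
    ext j
    exact congrFun this j
  · intro l hl
    simp only [Finset.mem_filter, mem_lists', Finset.mem_range] at hl
    obtain ⟨⟨h1, h2⟩, h3⟩ := hl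
    have hlen : l.length = n := by
      have : l.toFinset = Finset.range n := by ext a; simp [h2]
      rw [← List.toFinset_card_of_nodup h1, this, Finset.card_range]
    subst hlen
    let φ : Fin l.length → Fin l.length := fun i => ⟨l[i], (h2 _).1 (List.getElem_mem _)⟩
    have hφ : Function.Injective φ := by
      intro i j hij
      have : l[i] = l[j] := congrArg Fin.val hij
      exact Fin.ext ((List.Nodup.getElem_inj_iff h1).1 this)
    let σ := Equiv.ofBijective φ (Finite.injective_iff_bijective.1 hφ)
    have hσ : List.ofFn (fun j => (σ j : ℕ)) = l := by
      apply List.ext_getElem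
      · simp
      · intro i h h'
        simp [σ, φ]
    refine ⟨σ, ?_, hσ⟩
    simp only [Finset.mem_filter, Finset.mem_univ, true_and]
    rw [good_iff, hσ]; exact h3

theorem fCount_le (n : ℕ) : fCount n ≤ n.factorial := by
  rw [fCount]
  have := Finite.card_subtype_le (fun σ : Equiv.Perm (Fin n) => GoodPerm σ)
  rwa [Nat.card_eq_fintype_card (α := Equiv.Perm (Fin n)), Fintype.card_perm, Fintype.card_fin] at this

open PowerSeries in
noncomputable def Ev (A : PowerSeries ℝ) : PowerSeries ℝ :=
  PowerSeries.mk (fun n => if n % 2 = 0 then PowerSeries.coeff n A else 0)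
noncomputable def Od (A : PowerSeries ℝ) : PowerSeries ℝ :=
  PowerSeries.mk (fun n => if n % 2 = 0 then 0 else PowerSeries.coeff n A)
noncomputable def egf (a : ℕ → ℝ) : PowerSeries ℝ := PowerSeries.mk (fun n => a n / n.factorial)

theorem two_Ev (A : PowerSeries ℝ) : 2 * Ev A = A + PowerSeries.evalNegHom A := by
  ext n
  rw [two_mul, map_add, map_add, Ev, PowerSeries.evalNegHom, PowerSeries.coeff_mk, PowerSeries.coeff_rescale]
  split_ifs with h
  · rw [Even.neg_one_pow (Nat.even_iff.2 h)]; ring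
  · rw [Odd.neg_one_pow (Nat.odd_iff.2 (by omega))]; ring

theorem two_Od (A : PowerSeries ℝ) : 2 * Od A = A - PowerSeries.evalNegHom A := by
  ext n
  rw [two_mul, map_add, map_sub, Od, PowerSeries.evalNegHom, PowerSeries.coeff_mk, PowerSeries.coeff_rescale]
  split_ifs with h
  · rw [Even.neg_one_pow (Nat.even_iff.2 h)]; ring
  · rw [Odd.neg_one_pow (Nat.odd_iff.2 (by omega))]; ring

theorem d_egf (a : ℕ → ℝ) : PowerSeries.derivative ℝ (egf a) = egf (fun n => a (n + 1)) := by
  ext n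
  rw [PowerSeries.coeff_derivative, egf, egf, PowerSeries.coeff_mk, PowerSeries.coeff_mk,
    Nat.factorial_succ]
  push_cast
  have : (n.factorial : ℝ) ≠ 0 := by positivity
  field_simp

/-- uniqueness -/
theorem uniq (P Q P' Q' : PowerSeries ℝ)
    (h1 : PowerSeries.derivative ℝ P = Ev P * P + Od Q)
    (h2 : PowerSeries.derivative ℝ Q = Ev P * (P - Q) + Od Q)
    (h1' : PowerSeries.derivative ℝ P' = Ev P' * P' + Od Q')
    (h2' : PowerSeries.derivative ℝ Q' = Ev P' * (P' - Q') + Od Q')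
    (hP : PowerSeries.coeff 0 P = PowerSeries.coeff 0 P')
    (hQ : PowerSeries.coeff 0 Q = PowerSeries.coeff 0 Q') : P = P' := by
  have key : ∀ n, PowerSeries.coeff n P = PowerSeries.coeff n P' ∧
      PowerSeries.coeff n Q = PowerSeries.coeff n Q' := by
    intro n
    induction n using Nat.strong_induction_on with
    | _ n ih =>
      cases n with
      | zero => exact ⟨hP, hQ⟩
      | succ n =>
        have e : ∀ k ≤ n, PowerSeries.coeff k (Ev P) = PowerSeries.coeff k (Ev P') := by
          intro k hk
          simp only [Ev, PowerSeries.coeff_mk, (ih k (by omega)).1]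
        have o : PowerSeries.coeff n (Od Q) = PowerSeries.coeff n (Od Q') := by
          simp only [Od, PowerSeries.coeff_mk, (ih n (by omega)).2]
        have hn : (n : ℝ) + 1 ≠ 0 := by positivity
        constructor
        · apply mul_right_cancel₀ hn
          rw [← PowerSeries.coeff_derivative, ← PowerSeries.coeff_derivative, h1, h1', map_add, map_add, o,
            PowerSeries.coeff_mul, PowerSeries.coeff_mul]
          congr 1
          apply Finset.sum_congr rfl
          rintro ⟨i, j⟩ hij
          rw [Finset.HasAntidiagonal.mem_antidiagonal] at hij
          simp only at hij ⊢
          rw [e i (by omega), (ih j (by omega)).1]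
        · apply mul_right_cancel₀ hn
          rw [← PowerSeries.coeff_derivative, ← PowerSeries.coeff_derivative, h2, h2', map_add, map_add, o,
            PowerSeries.coeff_mul, PowerSeries.coeff_mul]
          congr 1
          apply Finset.sum_congr rfl
          rintro ⟨i, j⟩ hij
          rw [Finset.HasAntidiagonal.mem_antidiagonal] at hij
          simp only at hij ⊢
          rw [e i (by omega), map_sub, map_sub, (ih j (by omega)).1, (ih j (by omega)).2]
  ext n
  exact (key n).1

noncomputable def PF : PowerSeries ℝ := egf (fun n => fN n)
noncomputable def PG : PowerSeries ℝ := egf (fun n => gN n)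

theorem d_aux (u w : ℕ → ℕ) (h : ∀ n, u (n + 1) =
      ∑ k ∈ Finset.range (n + 1), n.choose k * (if k % 2 = 0 then fN k * w (n - k) else
        if k = n then gN n else 0)) :
    PowerSeries.derivative ℝ (egf (fun n => u n)) = Ev PF * egf (fun n => w n) + Od PG := by
  rw [d_egf]
  ext n
  rw [map_add, PowerSeries.coeff_mul, Finset.Nat.sum_antidiagonal_eq_sum_range_succ_mk]
  simp only [egf, PF, PG, Ev, Od, PowerSeries.coeff_mk, h]
  have : ∀ k ∈ Finset.range (n + 1), (((n.choose k * (if k % 2 = 0 then fN k * w (n - k) else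
        if k = n then gN n else 0) : ℕ) : ℝ) / n.factorial) =
      (if k % 2 = 0 then (fN k : ℝ) / k.factorial else 0) * (w (n - k) / (n - k).factorial) +
      (if k = n then (if n % 2 = 0 then 0 else (gN n : ℝ) / n.factorial) else 0) := by
    intro k hk
    have hk' : k ≤ n := by simpa [Nat.lt_succ_iff] using hk
    have hf : (n.factorial : ℝ) = n.choose k * k.factorial * (n - k).factorial := by
      exact_mod_cast (Nat.choose_mul_factorial_mul_factorial hk').symm
    have c1 : (n.choose k : ℝ) ≠ 0 := by
      have := Nat.choose_pos hk'
      positivity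
    have c2 : (k.factorial : ℝ) ≠ 0 := by positivity
    have c3 : ((n - k).factorial : ℝ) ≠ 0 := by positivity
    by_cases he : k % 2 = 0
    · have : (if k = n then (if n % 2 = 0 then 0 else (gN n : ℝ) / n.factorial) else 0) = 0 := by
        split_ifs with h1 h2
        · rfl
        · subst h1; exact absurd he h2
        · rfl
      rw [this, if_pos he, if_pos he, hf]
      push_cast
      field_simp
      ring
    · rw [if_neg he, if_neg he]
      by_cases hkn : k = n
      · subst hkn
        simp [he]
      · simp [hkn]
  push_cast [Finset.sum_div] at this ⊢
  rw [Finset.sum_congr rfl this, Finset.sum_add_distrib]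
  simp

theorem d_PF : PowerSeries.derivative ℝ PF = Ev PF * PF + Od PG := d_aux fN fN rec_f

theorem d_PG : PowerSeries.derivative ℝ PG = Ev PF * (PF - PG) + Od PG := by
  have : PF - PG = egf (fun n => hN n) := by
    ext n
    simp only [PF, PG, egf, map_sub, PowerSeries.coeff_mk, fN_eq]
    push_cast; ring
  rw [this]
  exact d_aux gN hN rec_g

/-! trigonometric series -/
noncomputable def psc : PowerSeries ℝ := egf (fun n => (1/2)^n * (if n % 2 = 0 then (-1)^(n/2) else 0))
noncomputable def pss : PowerSeries ℝ := egf (fun n => (1/2)^n * (if n % 2 = 0 then 0 else (-1)^(n/2)))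
noncomputable def psC : PowerSeries ℝ := egf (fun n => (√3/2)^n * (if n % 2 = 0 then 1 else 0))
noncomputable def psS : PowerSeries ℝ := egf (fun n => (√3/2)^n * (if n % 2 = 0 then 0 else 1))
noncomputable def psr : PowerSeries ℝ := PowerSeries.C (√3)

theorem psr_sq : psr * psr = 3 := by
  rw [psr, ← map_mul, Real.mul_self_sqrt (by norm_num)]; rfl

theorem d_psr : PowerSeries.derivative ℝ psr = 0 := by
  rw [psr, PowerSeries.derivative_C]

theorem coeff_two_mul (n : ℕ) (A : PowerSeries ℝ) :
    PowerSeries.coeff n (2 * A) = 2 * PowerSeries.coeff n A := by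
  rw [two_mul, map_add, two_mul]

theorem d_psc : 2 * PowerSeries.derivative ℝ psc = - pss := by
  rw [psc, d_egf]
  ext n
  rw [coeff_two_mul, pss, map_neg, egf, egf, PowerSeries.coeff_mk, PowerSeries.coeff_mk]
  rcases Nat.even_or_odd' n with ⟨k, rfl | rfl⟩
  · rw [if_neg (by omega), if_pos (by omega)]; ring
  · rw [if_pos (by omega), if_neg (by omega), show (2 * k + 1 + 1) / 2 = k + 1 by omega,
      show (2 * k + 1) / 2 = k by omega]; ring

theorem d_pss : 2 * PowerSeries.derivative ℝ pss = psc := by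
  rw [pss, d_egf]
  ext n
  rw [coeff_two_mul, psc, egf, egf, PowerSeries.coeff_mk, PowerSeries.coeff_mk]
  rcases Nat.even_or_odd' n with ⟨k, rfl | rfl⟩
  · rw [if_neg (by omega), if_pos (by omega), show (2 * k + 1) / 2 = k by omega,
      show (2 * k) / 2 = k by omega]; ring
  · rw [if_pos (by omega), if_neg (by omega)]; ring

theorem d_psC : 2 * PowerSeries.derivative ℝ psC = psr * psS := by
  rw [psC, d_egf]
  ext n
  rw [coeff_two_mul, psr, PowerSeries.coeff_C_mul, psS, egf, egf, PowerSeries.coeff_mk, PowerSeries.coeff_mk]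
  rcases Nat.even_or_odd' n with ⟨k, rfl | rfl⟩
  · rw [if_neg (by omega), if_pos (by omega)]; ring
  · rw [if_pos (by omega), if_neg (by omega)]; ring

theorem d_psS : 2 * PowerSeries.derivative ℝ psS = psr * psC := by
  rw [psS, d_egf]
  ext n
  rw [coeff_two_mul, psr, PowerSeries.coeff_C_mul, psC, egf, egf, PowerSeries.coeff_mk, PowerSeries.coeff_mk]
  rcases Nat.even_or_odd' n with ⟨k, rfl | rfl⟩
  · rw [if_neg (by omega), if_pos (by omega)]; ring
  · rw [if_pos (by omega), if_neg (by omega)]; ring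

theorem const_psc : PowerSeries.constantCoeff psc = 1 := by
  rw [← PowerSeries.coeff_zero_eq_constantCoeff_apply, psc, egf, PowerSeries.coeff_mk]; simp
theorem const_pss : PowerSeries.constantCoeff pss = 0 := by
  rw [← PowerSeries.coeff_zero_eq_constantCoeff_apply, pss, egf, PowerSeries.coeff_mk]; simp
theorem const_psC : PowerSeries.constantCoeff psC = 1 := by
  rw [← PowerSeries.coeff_zero_eq_constantCoeff_apply, psC, egf, PowerSeries.coeff_mk]; simp
theorem const_psS : PowerSeries.constantCoeff psS = 0 := by
  rw [← PowerSeries.coeff_zero_eq_constantCoeff_apply, psS, egf, PowerSeries.coeff_mk]; simp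

theorem const3 : PowerSeries.constantCoeff (3 : PowerSeries ℝ) = 3 := by
  have : (3 : PowerSeries ℝ) = PowerSeries.C 3 := rfl
  rw [this, PowerSeries.constantCoeff_C]
theorem const2 : PowerSeries.constantCoeff (2 : PowerSeries ℝ) = 2 := by
  have : (2 : PowerSeries ℝ) = PowerSeries.C 2 := rfl
  rw [this, PowerSeries.constantCoeff_C]

theorem two_ne : (2 : PowerSeries ℝ) ≠ 0 := by
  intro h
  have := congrArg PowerSeries.constantCoeff h
  simp [const2] at this

theorem trig1 : psc * psc + pss * pss = 1 := by
  apply PowerSeries.derivative.ext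
  · simp only [map_add, Derivation.leibniz, smul_eq_mul, PowerSeries.derivative_one]
    linear_combination psc * d_psc + pss * d_pss
  · simp [const_psc, const_pss]

theorem trig2 : psC * psC - psS * psS = 1 := by
  apply PowerSeries.derivative.ext
  · simp only [map_sub, Derivation.leibniz, smul_eq_mul, PowerSeries.derivative_one]
    linear_combination psC * d_psC - psS * d_psS
  · simp [const_psC, const_psS]

theorem neg_egf_even (a b : ℕ → ℝ) (h : ∀ n, (-1) ^ n * a n = b n) :
    PowerSeries.evalNegHom (egf a) = egf b := by
  ext n
  rw [PowerSeries.evalNegHom, PowerSeries.coeff_rescale, egf, egf, PowerSeries.coeff_mk,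
    PowerSeries.coeff_mk, ← h]; ring

theorem neg_psc : PowerSeries.evalNegHom psc = psc := by
  apply neg_egf_even
  intro n
  split_ifs with h
  · rw [Even.neg_one_pow (Nat.even_iff.2 h)]; ring
  · ring
theorem neg_psC : PowerSeries.evalNegHom psC = psC := by
  apply neg_egf_even
  intro n
  split_ifs with h
  · rw [Even.neg_one_pow (Nat.even_iff.2 h)]; ring
  · ring
theorem neg_pss : PowerSeries.evalNegHom pss = -pss := by
  have : -pss = egf (fun n => -((1/2)^n * (if n % 2 = 0 then 0 else (-1)^(n/2)))) := by
    ext n; simp only [pss, egf, map_neg, PowerSeries.coeff_mk]; ring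
  rw [this]
  apply neg_egf_even
  intro n
  split_ifs with h
  · ring
  · rw [Odd.neg_one_pow (Nat.odd_iff.2 (by omega))]; ring
theorem neg_psS : PowerSeries.evalNegHom psS = -psS := by
  have : -psS = egf (fun n => -((√3/2)^n * (if n % 2 = 0 then 0 else 1))) := by
    ext n; simp only [psS, egf, map_neg, PowerSeries.coeff_mk]; ring
  rw [this]
  apply neg_egf_even
  intro n
  split_ifs with h
  · ring
  · rw [Odd.neg_one_pow (Nat.odd_iff.2 (by omega))]; ring
theorem neg_psr : PowerSeries.evalNegHom psr = psr := by
  rw [psr, PowerSeries.evalNegHom]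
  ext n
  rw [PowerSeries.coeff_rescale, PowerSeries.coeff_C]
  split_ifs with h
  · subst h; simp
  · simp

noncomputable def psD : PowerSeries ℝ := 3 * psc - psr * psS
noncomputable def psD' : PowerSeries ℝ := 3 * psc + psr * psS
noncomputable def psN : PowerSeries ℝ := 3 * pss + 3 * psC
noncomputable def psN' : PowerSeries ℝ := 3 * psC - 3 * pss

theorem neg_D : PowerSeries.evalNegHom psD = psD' := by
  simp only [psD, psD', map_sub, map_mul, neg_psc, neg_psr, neg_psS, map_ofNat]; ring
theorem neg_D' : PowerSeries.evalNegHom psD' = psD := by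
  simp only [psD, psD', map_add, map_mul, neg_psc, neg_psr, neg_psS, map_ofNat]; ring
theorem neg_N : PowerSeries.evalNegHom psN = psN' := by
  simp only [psN, psN', map_add, map_mul, neg_pss, neg_psC, map_ofNat]; ring
theorem neg_N' : PowerSeries.evalNegHom psN' = psN := by
  simp only [psN, psN', map_sub, map_mul, neg_pss, neg_psC, map_ofNat]; ring

theorem d_three : PowerSeries.derivative ℝ (3 : PowerSeries ℝ) = 0 := by
  have : (3 : PowerSeries ℝ) = PowerSeries.C 3 := rfl
  rw [this, PowerSeries.derivative_C]

theorem d_two : PowerSeries.derivative ℝ (2 : PowerSeries ℝ) = 0 := by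
  have : (2 : PowerSeries ℝ) = PowerSeries.C 2 := rfl
  rw [this, PowerSeries.derivative_C]

theorem d_D : 2 * PowerSeries.derivative ℝ psD = - psN := by
  simp only [psD, psN, map_sub, Derivation.leibniz, smul_eq_mul, d_three, d_psr]
  linear_combination 3 * d_psc - psr * d_psS - psC * psr_sq
theorem d_D' : 2 * PowerSeries.derivative ℝ psD' = psN' := by
  simp only [psD', psN', map_add, Derivation.leibniz, smul_eq_mul, d_three, d_psr]
  linear_combination 3 * d_psc + psr * d_psS + psC * psr_sq
theorem d_N : 2 * PowerSeries.derivative ℝ psN = 3 * psc + 3 * psr * psS := by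
  simp only [psN, map_add, Derivation.leibniz, smul_eq_mul, d_three]
  linear_combination 3 * d_pss + 3 * d_psC
theorem d_N' : 2 * PowerSeries.derivative ℝ psN' = 3 * psr * psS - 3 * psc := by
  simp only [psN', map_sub, Derivation.leibniz, smul_eq_mul, d_three]
  linear_combination - 3 * d_pss + 3 * d_psC

theorem D_inv : psD * psD⁻¹ = 1 := by
  apply PowerSeries.mul_inv_cancel
  simp [psD, const3, const_psc, const_psS]
theorem D'_inv : psD' * psD'⁻¹ = 1 := by
  apply PowerSeries.mul_inv_cancel
  simp [psD', const3, const_psc, const_psS]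

theorem neg_u : PowerSeries.evalNegHom psD⁻¹ = psD'⁻¹ := by
  have h := congrArg PowerSeries.evalNegHom D_inv
  rw [map_mul, neg_D, map_one] at h
  linear_combination psD'⁻¹ * h - PowerSeries.evalNegHom psD⁻¹ * D'_inv
theorem neg_v : PowerSeries.evalNegHom psD'⁻¹ = psD⁻¹ := by
  have h := congrArg PowerSeries.evalNegHom D'_inv
  rw [map_mul, neg_D', map_one] at h
  linear_combination psD⁻¹ * h - PowerSeries.evalNegHom psD'⁻¹ * D_inv

theorem key1 : (3 * psc + 3 * psr * psS) * psD' = psN * psN' + psD' * psD' - psD * psD := by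
  simp only [psD, psD', psN, psN']
  linear_combination 3 * psS * psS * psr_sq + 9 * trig1 - 9 * trig2
theorem key2 : (3 * psc - 3 * psr * psS) * psD = psN * psN' + psD * psD - psD' * psD' := by
  simp only [psD, psD', psN, psN']
  linear_combination 3 * psS * psS * psr_sq + 9 * trig1 - 9 * trig2

noncomputable def cF : PowerSeries ℝ := psN * psD⁻¹
noncomputable def psh : PowerSeries ℝ := PowerSeries.C (1/2)
theorem psh_two : 2 * psh = 1 := by
  have : (2 : PowerSeries ℝ) = PowerSeries.C 2 := rfl
  rw [psh, this, ← map_mul]; norm_num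
theorem neg_psh : PowerSeries.evalNegHom psh = psh := by
  rw [psh, PowerSeries.evalNegHom]
  ext n
  rw [PowerSeries.coeff_rescale, PowerSeries.coeff_C]
  split_ifs with h
  · subst h; simp
  · simp
theorem d_psh : PowerSeries.derivative ℝ psh = 0 := by
  rw [psh, PowerSeries.derivative_C]
noncomputable def cG : PowerSeries ℝ :=
  psh * (psN * psD⁻¹ + psN' * psD'⁻¹) - psD * psD'⁻¹

theorem ev_cF : 2 * Ev cF = psN * psD⁻¹ + psN' * psD'⁻¹ := by
  rw [two_Ev, cF, map_mul, neg_N, neg_u]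
theorem od_cG : 2 * Od cG = psD' * psD⁻¹ - psD * psD'⁻¹ := by
  rw [two_Od, cG]
  simp only [map_sub, map_add, map_mul, neg_psh, neg_N, neg_N', neg_u, neg_v, neg_D]
  ring

theorem d_cF : PowerSeries.derivative ℝ cF = Ev cF * cF + Od cG := by
  apply mul_left_cancel₀ two_ne
  have e := ev_cF
  have o := od_cG
  have dF : 2 * PowerSeries.derivative ℝ cF =
      (3 * psc + 3 * psr * psS) * psD⁻¹ + psN * psN * psD⁻¹ * psD⁻¹ := by
    simp only [cF, Derivation.leibniz, smul_eq_mul, PowerSeries.derivative_inv']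
    linear_combination psD⁻¹ * d_N - psN * psD⁻¹ * psD⁻¹ * d_D
  rw [dF, mul_add, ← mul_assoc, e, o, cF]
  have k := key1
  have hu := D_inv
  have hv := D'_inv
  generalize psD⁻¹ = u at *
  generalize psD'⁻¹ = v at *
  linear_combination u * v * k - (3 * psc + 3 * psr * psS) * u * hv + psD' * u * hv - psD * v * hu

theorem d_cG : PowerSeries.derivative ℝ cG = Ev cF * (cF - cG) + Od cG := by
  apply mul_left_cancel₀ two_ne
  apply mul_left_cancel₀ two_ne
  have e := ev_cF
  have o := od_cG
  have dG : 2 * (2 * PowerSeries.derivative ℝ cG) =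
      (3 * psc + 3 * psr * psS) * psD⁻¹ + psN * psN * psD⁻¹ * psD⁻¹
      + (3 * psr * psS - 3 * psc) * psD'⁻¹ - psN' * psN' * psD'⁻¹ * psD'⁻¹
      + 2 * (psN * psD'⁻¹ + psD * psN' * psD'⁻¹ * psD'⁻¹) := by
    simp only [cG, map_sub, map_add, Derivation.leibniz, smul_eq_mul, PowerSeries.derivative_inv', d_psh]
    have h2 := psh_two
    have a1 := d_N
    have a2 := d_N'
    have a3 := d_D
    have a4 := d_D'
    generalize psD⁻¹ = u at *
    generalize psD'⁻¹ = v at *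
    generalize PowerSeries.derivative ℝ psN = n1 at *
    generalize PowerSeries.derivative ℝ psN' = n2 at *
    generalize PowerSeries.derivative ℝ psD = n3 at *
    generalize PowerSeries.derivative ℝ psD' = n4 at *
    linear_combination (2 * (n1 * u - psN * u^2 * n3 + n2 * v - psN' * v^2 * n4)) * h2 +
      u * a1 - psN * u * u * a3 + v * a2 - psN' * v * v * a4 - 2 * v * a3 + 2 * psD * v * v * a4
  have hcG : 2 * cG = psN * psD⁻¹ + psN' * psD'⁻¹ - 2 * psD * psD'⁻¹ := by
    rw [cG]; linear_combination (psN * psD⁻¹ + psN' * psD'⁻¹) * psh_two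
  have : 2 * (2 * (Ev cF * (cF - cG) + Od cG)) = (2 * Ev cF) * (2 * cF - 2 * cG) + 2 * (2 * Od cG) := by
    ring
  rw [dG, this, e, o, hcG, cF]
  have k := key1
  have k2 := key2
  have hu := D_inv
  have hv := D'_inv
  generalize psD⁻¹ = u at *
  generalize psD'⁻¹ = v at *
  linear_combination u * v * (k - k2) - (3 * psc + 3 * psr * psS) * u * hv
    + (3 * psc - 3 * psr * psS) * v * hu + 2 * psD' * u * hv - 2 * psD * v * hu - 2 * psN * v * hu

theorem main_ps : psD * PF = psN := by
  have : PF = cF := by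
    apply uniq PF PG cF cG d_PF d_PG d_cF d_cG
    · simp [PF, egf, fN_zero, cF, psN, psD, const3, const_psc, const_psS, const_psC, const_pss]
    · simp [PG, egf, gN_zero, cG, psN, psD, psN', psD', psh, const3, const_psc, const_psS, const_psC, const_pss]
      norm_num
  rw [this, cF]
  linear_combination psN * D_inv

/-! evaluation -/
def PwSum (A : PowerSeries ℝ) (x y : ℝ) : Prop := HasSum (fun n => PowerSeries.coeff n A * x ^ n) y

theorem hasSum_congr' {f g : ℕ → ℝ} {y : ℝ} (h : HasSum f y) (hfg : ∀ n, g n = f n) :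
    HasSum g y := by
  rw [show g = f from funext hfg]; exact h

theorem PwSum.add {A B : PowerSeries ℝ} {x y z : ℝ} (h : PwSum A x y) (h' : PwSum B x z) :
    PwSum (A + B) x (y + z) := by
  unfold PwSum at *
  convert HasSum.add h h' using 2
  rw [map_add]; ring
theorem PwSum.sub {A B : PowerSeries ℝ} {x y z : ℝ} (h : PwSum A x y) (h' : PwSum B x z) :
    PwSum (A - B) x (y - z) := by
  unfold PwSum at *
  refine hasSum_congr' (HasSum.sub h h') (fun n => ?_)
  rw [map_sub]; ring
theorem PwSum.C_mul {A : PowerSeries ℝ} {x y : ℝ} (c : ℝ) (h : PwSum A x y) :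
    PwSum (PowerSeries.C c * A) x (c * y) := by
  unfold PwSum at *
  refine hasSum_congr' (HasSum.mul_left c h) (fun n => ?_)
  rw [PowerSeries.coeff_C_mul]; ring
theorem PwSum.mul {A B : PowerSeries ℝ} {x y z : ℝ} (h : PwSum A x y) (h' : PwSum B x z) :
    PwSum (A * B) x (y * z) := by
  unfold PwSum at *
  have s1 := (summable_norm_iff.2 h.summable)
  have s2 := (summable_norm_iff.2 h'.summable)
  have := (summable_norm_sum_mul_antidiagonal_of_summable_norm s1 s2).of_norm.hasSum
  rw [← tsum_mul_tsum_eq_tsum_sum_antidiagonal_of_summable_norm s1 s2, h.tsum_eq, h'.tsum_eq] at this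
  refine hasSum_congr' this (fun n => ?_)
  rw [PowerSeries.coeff_mul, Finset.sum_mul]
  apply Finset.sum_congr rfl
  rintro ⟨i, j⟩ hij
  rw [Finset.HasAntidiagonal.mem_antidiagonal] at hij
  simp only at hij ⊢
  rw [← hij, pow_add]; ring

theorem sum_psc (x : ℝ) : PwSum psc x (Real.cos (x / 2)) := by
  unfold PwSum
  have h := Real.hasSum_cos (x / 2)
  rw [← add_zero (Real.cos (x / 2))]
  apply HasSum.even_add_odd
  · convert h using 2 with n
    simp [psc, egf, div_pow, pow_mul]; ring
  · convert hasSum_zero using 2 with n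
    simp [psc, egf, Nat.add_mod]
theorem sum_pss (x : ℝ) : PwSum pss x (Real.sin (x / 2)) := by
  unfold PwSum
  have h := Real.hasSum_sin (x / 2)
  rw [← zero_add (Real.sin (x / 2))]
  apply HasSum.even_add_odd
  · convert hasSum_zero using 2 with n
    simp [pss, egf]
  · convert h using 2 with n
    have : (2 * n + 1) / 2 = n := by omega
    simp [pss, egf, Nat.add_mod, this, div_pow]; ring
theorem sum_psC (x : ℝ) : PwSum psC x (Real.cosh (√3 * x / 2)) := by
  unfold PwSum
  have h := Real.hasSum_cosh (√3 * x / 2)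
  rw [← add_zero (Real.cosh (√3 * x / 2))]
  apply HasSum.even_add_odd
  · convert h using 2 with n
    simp [psC, egf, div_pow, mul_pow]; ring
  · convert hasSum_zero using 2 with n
    simp [psC, egf, Nat.add_mod]
theorem sum_psS (x : ℝ) : PwSum psS x (Real.sinh (√3 * x / 2)) := by
  unfold PwSum
  have h := Real.hasSum_sinh (√3 * x / 2)
  rw [← zero_add (Real.sinh (√3 * x / 2))]
  apply HasSum.even_add_odd
  · convert hasSum_zero using 2 with n
    simp [psS, egf]
  · convert h using 2 with n
    simp [psS, egf, Nat.add_mod, div_pow, mul_pow]; ring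

theorem sum_psD (x : ℝ) : PwSum psD x (3 * Real.cos (x / 2) - √3 * Real.sinh (√3 * x / 2)) :=
  ((sum_psc x).C_mul 3).sub ((sum_psS x).C_mul (√3))
theorem sum_psN (x : ℝ) : PwSum psN x (3 * Real.sin (x / 2) + 3 * Real.cosh (√3 * x / 2)) :=
  ((sum_pss x).C_mul 3).add ((sum_psC x).C_mul 3)

/-- for real `x` with `|x| < 1`, the series `Σ f(n)·xⁿ/n!` converges
absolutely, and `(3·cos(x/2) − √3·sinh(√3·x/2)) · Σₙ f(n)·xⁿ/n! = 3·sin(x/2) + 3·cosh(√3·x/2)`. -/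
theorem statement3 (x : ℝ) (hx : |x| < 1) :
    Summable (fun n : ℕ => |(fCount n : ℝ) * x ^ n / n.factorial|) ∧
    (3 * Real.cos (x / 2) - Real.sqrt 3 * Real.sinh (Real.sqrt 3 * x / 2)) *
        (∑' n : ℕ, (fCount n : ℝ) * x ^ n / n.factorial) =
      3 * Real.sin (x / 2) + 3 * Real.cosh (Real.sqrt 3 * x / 2) := by
  have hs : Summable (fun n : ℕ => |(fCount n : ℝ) * x ^ n / n.factorial|) := by
    refine Summable.of_nonneg_of_le (fun n => abs_nonneg _) (fun n => ?_)
      (summable_geometric_of_lt_one (abs_nonneg x) hx)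
    have h0 : (0 : ℝ) < n.factorial := by positivity
    have h1 : (fCount n : ℝ) ≤ n.factorial := by exact_mod_cast fCount_le n
    rw [abs_div, abs_mul, abs_pow, Nat.abs_cast, Nat.abs_cast, div_le_iff₀ h0, mul_comm]
    exact mul_le_mul_of_nonneg_left h1 (by positivity)
  refine ⟨hs, ?_⟩
  have hP : PwSum PF x (∑' n : ℕ, (fCount n : ℝ) * x ^ n / n.factorial) := by
    refine hasSum_congr' (summable_abs_iff.1 hs).hasSum (fun n => ?_)
    rw [PF, egf, PowerSeries.coeff_mk, fCount_eq]; ring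
  have h := (sum_psD x).mul hP
  rw [main_ps] at h
  exact HasSum.unique h (sum_psN x)
end
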